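/- Let Ω, Ω′ ∈ RTSeq with |Ω| ≤ |Ω′|. Then (u(Ω), v(Ω)) = (u(Ω′), v(Ω′)) if and only if Ω′ is obtained from Ω by prepending |Ω′| − |Ω| copies of the letter r₁, i.e. Ω′ = r₁^{|Ω′|−|Ω|} Ω. -/

import Mathlib

/-!
Statement 16.  Let `Ω, Ω′ ∈ RTSeq` with `|Ω| ≤ |Ω′|`.  Then
`(u(Ω), v(Ω)) = (u(Ω′), v(Ω′))` iff `Ω′ = r₁^{|Ω′|−|Ω|} Ω` (prepending copies of `r₁`,
which is the letter `RTLetter.r 0` in our 0-indexed encoding).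
-/

/-- Permutations of the positive integers are modelled by `Equiv.Perm ℕ`, the positive
integer `p` corresponding to `p − 1 : ℕ`.  The insertion map `ins_i` (here `ins (i-1)`,
`0`-indexed) sends `j ↦ w(j) + 1` for `j < i`, `i ↦ 0`, and `j ↦ w(j−1) + 1` for `j > i`. -/
def ins (i : ℕ) (w : Equiv.Perm ℕ) : Equiv.Perm ℕ where
  toFun j := if j < i then w j + 1 else if j = i then 0 else w (j - 1) + 1
  invFun b := if b = 0 then i else if w.symm (b - 1) < i then w.symm (b - 1) else w.symm (b - 1) + 1
  left_inv := by
    intro j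
    dsimp only
    by_cases h1 : j < i
    · rw [if_pos h1, if_neg (by omega : ¬ (w j + 1 = 0)), Nat.add_sub_cancel,
        Equiv.symm_apply_apply, if_pos h1]
    · by_cases h2 : j = i
      · rw [if_neg h1, if_pos h2, if_pos rfl, h2]
      · rw [if_neg h1, if_neg h2, if_neg (by omega : ¬ (w (j - 1) + 1 = 0)),
          Nat.add_sub_cancel, Equiv.symm_apply_apply,
          if_neg (by omega : ¬ (j - 1 < i)), Nat.sub_add_cancel (by omega)]
  right_inv := by
    intro b
    dsimp only
    by_cases hb : b = 0
    · rw [if_pos hb, if_neg (lt_irrefl i), if_pos rfl, hb]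
    · rw [if_neg hb]
      by_cases hc : w.symm (b - 1) < i
      · rw [if_pos hc, if_pos hc, Equiv.apply_symm_apply, Nat.sub_add_cancel (by omega)]
      · rw [if_neg hc, if_neg (by omega : ¬ (w.symm (b - 1) + 1 < i)),
          if_neg (by omega : ¬ (w.symm (b - 1) + 1 = i)), Nat.add_sub_cancel,
          Equiv.apply_symm_apply, Nat.sub_add_cancel (by omega)]

/-- The number `ℓ(u)` of inversions of `u`. -/
noncomputable def invCount (u : Equiv.Perm ℕ) : ℕ :=
  Set.ncard {p : ℕ × ℕ | p.1 < p.2 ∧ u p.2 < u p.1}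

/-- The Bruhat order: `u ≤ v` iff there is a chain `u = w₀, …, w_m = v` where each
`w_{s+1} = w_s · τ_s` for a transposition `τ_s`, with `ℓ(w_{s+1}) > ℓ(w_s)`. -/
noncomputable def bruhatLE (u v : Equiv.Perm ℕ) : Prop :=
  ∃ (m : ℕ) (c : ℕ → Equiv.Perm ℕ), c 0 = u ∧ c m = v ∧
    ∀ s < m, (∃ a b : ℕ, a ≠ b ∧ c (s + 1) = c s * Equiv.swap a b) ∧
      invCount (c s) < invCount (c (s + 1))

/-- `ℓ_a(u) = #{b ≥ a : u⁻¹(b) ≤ u⁻¹(a)}` (0-indexed: this is `ℓ_{a+1}` of the paper). -/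
noncomputable def lA (a : ℕ) (u : Equiv.Perm ℕ) : ℕ :=
  Set.ncard {b : ℕ | a ≤ b ∧ u.symm b ≤ u.symm a}

/-- `u` fixes all but finitely many points, i.e. `u ∈ S_∞`. -/
def finitary (u : Equiv.Perm ℕ) : Prop := {a : ℕ | u a ≠ a}.Finite

/-- `u ∈ S_n`: `u` fixes every point `j > n` (0-indexed: every `j ≥ n`). -/
def inSn (n : ℕ) (u : Equiv.Perm ℕ) : Prop := ∀ j, n ≤ j → u j = j

/-- The formal letters `r_j, t_j` (`j ≥ 1`); here `RTLetter.r k` stands for `r_{k+1}`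
and `RTLetter.t k` for `t_{k+1}`. -/
inductive RTLetter : Type
  | r : ℕ → RTLetter
  | t : ℕ → RTLetter
deriving DecidableEq

/-- One step of the recursion defining `(u(Ω), v(Ω))`:
`r_j` maps `(u,v) ↦ (ins_j u, ins_j v)` and `t_j` maps `(u,v) ↦ (ins_j u, ins_{j+1} v)`. -/
def stepRT (p : Equiv.Perm ℕ × Equiv.Perm ℕ) : RTLetter → Equiv.Perm ℕ × Equiv.Perm ℕ
  | .r k => (ins k p.1, ins k p.2)
  | .t k => (ins k p.1, ins (k + 1) p.2)

/-- The pair `(u(Ω), v(Ω))` attached to a sequence `Ω` (a list of letters, first letter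
first):  `u(∅) = v(∅) = id`, and the last letter is applied outermost. -/
def uv (L : List RTLetter) : Equiv.Perm ℕ × Equiv.Perm ℕ := L.foldl stepRT (1, 1)

/-- The letter at (0-indexed) position `p` of a sequence in `RTSeq_n` must lie in
`{r₁, t₁, …, r_{p}, t_{p}, r_{p+1}}` (1-indexed position `s = p+1`). -/
def validLetter (p : ℕ) : RTLetter → Prop
  | .r k => k ≤ p
  | .t k => k + 1 ≤ p

/-- `Ω ∈ RTSeq_n`: a sequence of `n` letters `X₁⋯X_n` with
`X_s ∈ {r₁, t₁, …, r_{s−1}, t_{s−1}, r_s}`. -/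
def validSeq (n : ℕ) (L : List RTLetter) : Prop :=
  L.length = n ∧ ∀ p < L.length, validLetter p (L.getD p (.r 0))

/-- `|Ω|_t`, the number of letters of the form `t_j`. -/
def countT (L : List RTLetter) : ℕ :=
  L.countP (fun X => match X with | .t _ => true | .r _ => false)

/-- `c_n`, the backwards long cycle `n 1 2 ⋯ (n−1)` (0-indexed on `ℕ`:
`0 ↦ n−1`, `j ↦ j−1` for `1 ≤ j ≤ n−1`, `j ↦ j` for `j ≥ n`). -/
def cB (n : ℕ) : Equiv.Perm ℕ where
  toFun j := if j = 0 then n - 1 else if j ≤ n - 1 then j - 1 else j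
  invFun j := if j = n - 1 then 0 else if j < n - 1 then j + 1 else j
  left_inv := by
    intro j
    dsimp only
    split_ifs <;> (try exact absurd rfl ‹_›) <;> (try exact (‹False›).elim) <;> omega
  right_inv := by
    intro j
    dsimp only
    split_ifs <;> (try exact absurd rfl ‹_›) <;> (try exact (‹False›).elim) <;> omega

/-- `Ω′` is obtained from `Ω` by replacing the letters `t_i` at some subset of the
positions by either `r_i` or `r_{i+1}`. -/
def isReplacement (L L' : List RTLetter) : Prop :=
  L'.length = L.length ∧
  ∀ p < L.length,
    L'.getD p (.r 0) = L.getD p (.r 0) ∨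
    ∃ k, L.getD p (.r 0) = .t k ∧ (L'.getD p (.r 0) = .r k ∨ L'.getD p (.r 0) = .r (k + 1))


theorem ins_symm_zero (i : ℕ) (w : Equiv.Perm ℕ) : (ins i w).symm 0 = i := rfl

theorem ins_injective2 : Function.Injective2 ins := by
  intro i i' w w' h
  have hi : i = i' := by rw [← ins_symm_zero i w, h, ins_symm_zero]
  subst hi
  refine ⟨rfl, Equiv.ext fun j => ?_⟩
  have key : ∀ k, ins i w k = ins i w' k := fun k => by rw [h]
  by_cases hj : j < i
  · simpa [ins, hj] using key j
  · have h1 : ¬ (j + 1 < i) := by omega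
    have h2 : j + 1 ≠ i := by omega
    simpa [ins, h1, h2] using key (j + 1)

theorem ins_zero_one : ins 0 1 = 1 := by
  ext j
  cases j <;> simp [ins]

theorem stepRT_injective2 : Function.Injective2 stepRT := by
  rintro ⟨u, v⟩ ⟨u', v'⟩ (k | k) (k' | k') h <;>
    obtain ⟨hu, hv⟩ := Prod.mk.inj h <;>
    obtain ⟨hk, rfl⟩ := ins_injective2 hu <;>
    obtain ⟨hk', rfl⟩ := ins_injective2 hv <;>
    first
      | exact ⟨rfl, congrArg _ hk⟩
      | omega

theorem uv_append_singleton (L : List RTLetter) (X : RTLetter) :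
    uv (L ++ [X]) = stepRT (uv L) X := by
  simp [uv]

theorem uv_replicate_append (n : ℕ) (L : List RTLetter) :
    uv (List.replicate n (RTLetter.r 0) ++ L) = uv L := by
  induction n with
  | zero => rfl
  | succ n ih =>
    rw [← ih]
    simp [uv, List.replicate_succ, stepRT, ins_zero_one]

/-- Sequences of a fixed length are determined by their pair of permutations. -/
theorem eq_of_uv_eq (L L' : List RTLetter) (hlen : L.length = L'.length)
    (h : uv L = uv L') : L = L' := by
  induction L using List.reverseRecOn generalizing L' with
  | nil => exact (List.length_eq_zero_iff.mp hlen.symm).symm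
  | append_singleton L X ih =>
    rcases L'.eq_nil_or_concat' with rfl | ⟨L', X', rfl⟩
    · simp at hlen
    · rw [uv_append_singleton, uv_append_singleton] at h
      obtain ⟨hp, rfl⟩ := stepRT_injective2 h
      rw [ih L' (by simpa using hlen) hp]

theorem stmt16 (L L' : List RTLetter) (h : L.length ≤ L'.length) :
    uv L = uv L' ↔ L' = List.replicate (L'.length - L.length) (RTLetter.r 0) ++ L := by
  refine ⟨fun huv => eq_of_uv_eq _ _ ?_ ?_, fun hL => ?_⟩
  · simp [h]
  · rw [uv_replicate_append, huv]
  · rw [hL, uv_replicate_append]
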